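/- arXiv:2312.00998 — 2 statements merged into one kernel-verified Lean document; each statement's English description precedes it below -/
import Mathlib

section
/- Let u : ℝⁿ → ℝ be a C² stable solution of -Δu = f(u) with f ∈ C¹, meaning ∫(|∇ψ|² - f'(u)ψ²) ≥ 0 for all ψ ∈ C_c^∞(ℝⁿ). Then for every Lipschitz compactly supported φ : ℝⁿ → ℝ, the Sternberg–Zumbrun inequality holds: ∫_{ℝⁿ} (‖∇²u‖² - |∇|∇u||²) φ² ≤ ∫_{ℝⁿ} |∇u|² |∇φ|², where the integrand on the left is interpreted as ‖∇²u‖² on the set where ∇u = 0. -/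
open MeasureTheory

variable {n : ℕ}

noncomputable def hessEntry (u : EuclideanSpace ℝ (Fin n) → ℝ)
    (x : EuclideanSpace ℝ (Fin n)) (i j : Fin n) : ℝ :=
  fderiv ℝ (fun y => fderiv ℝ u y (EuclideanSpace.single j 1)) x (EuclideanSpace.single i 1)

noncomputable def hessNormSq (u : EuclideanSpace ℝ (Fin n) → ℝ)
    (x : EuclideanSpace ℝ (Fin n)) : ℝ :=
  ∑ i, ∑ j, (hessEntry u x i j) ^ 2

noncomputable def gradNormGradSq (u : EuclideanSpace ℝ (Fin n) → ℝ)
    (x : EuclideanSpace ℝ (Fin n)) : ℝ :=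
  ‖gradient (fun y => ‖gradient u y‖) x‖ ^ 2

noncomputable def lap (u : EuclideanSpace ℝ (Fin n) → ℝ)
    (x : EuclideanSpace ℝ (Fin n)) : ℝ :=
  ∑ i, hessEntry u x i i

open Classical in
noncomputable def SZ (u : EuclideanSpace ℝ (Fin n) → ℝ)
    (x : EuclideanSpace ℝ (Fin n)) : ℝ :=
  hessNormSq u x - (if gradient u x = 0 then 0 else gradNormGradSq u x)

def Qcube (r : ℝ) (x : EuclideanSpace ℝ (Fin n)) : Set (EuclideanSpace ℝ (Fin n)) :=
  {y | ∀ i, |y i - x i| ≤ r / 2}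

def IsStableSolution (f : ℝ → ℝ) (u : EuclideanSpace ℝ (Fin n) → ℝ) : Prop :=
  (∀ x, -lap u x = f (u x)) ∧
  ∀ ψ : EuclideanSpace ℝ (Fin n) → ℝ, ContDiff ℝ (⊤ : ℕ∞) ψ → HasCompactSupport ψ →
    0 ≤ ∫ x, (‖gradient ψ x‖ ^ 2 - deriv f (u x) * ψ x ^ 2)

open Filter Topology ContinuousLinearMap Convolution in
lemma sz_approx {n : ℕ} {g : EuclideanSpace ℝ (Fin n) → ℝ} {K : NNReal}
    (hg : LipschitzWith K g) (hs : HasCompactSupport g) :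
    ∃ (G : ℕ → EuclideanSpace ℝ (Fin n) → ℝ) (R M : ℝ),
      (∀ k, ContDiff ℝ (⊤ : ℕ∞) (G k)) ∧
      (∀ k, tsupport (G k) ⊆ Metric.closedBall 0 R) ∧
      (∀ k x, ‖G k x‖ ≤ M) ∧ (∀ k x, ‖fderiv ℝ (G k) x‖ ≤ K) ∧
      (∀ x, Tendsto (fun k => G k x) atTop (𝓝 (g x))) ∧
      (∀ᵐ x, Tendsto (fun k => fderiv ℝ (G k) x) atTop (𝓝 (fderiv ℝ g x))) := by
  obtain ⟨R, hR⟩ := hs.isCompact.isBounded.subset_closedBall 0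
  obtain ⟨M, hM⟩ := hs.exists_bound_of_continuous hg.continuous
  let ρ : ℕ → ContDiffBump (0 : EuclideanSpace ℝ (Fin n)) := fun k =>
    ⟨1 / ((k : ℝ) + 1), 2 / ((k : ℝ) + 1), by positivity, by gcongr; norm_num⟩
  have hρ : Tendsto (fun k => (ρ k).rOut) atTop (𝓝 0) := by
    have h := (tendsto_one_div_add_atTop_nhds_zero_nat (𝕜 := ℝ)).const_mul 2
    simpa [ρ, div_eq_mul_inv] using h
  have hrho2 : ∀ k, (ρ k).rOut ≤ 2 := fun k => by
    change 2 / ((k : ℝ) + 1) ≤ 2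
    rw [div_le_iff₀ (by positivity)]
    have : (0 : ℝ) ≤ k := by positivity
    linarith
  have hbd : ∀ x, ‖fderiv ℝ g x‖ ≤ K := fun x => norm_fderiv_le_of_lipschitz ℝ hg
  have hmeas : Measurable (fderiv ℝ g) := measurable_fderiv ℝ g
  have hder : ∀ k x, HasFDerivAt ((ρ k).normed volume ⋆[lsmul ℝ ℝ, volume] g)
      (((ρ k).normed volume ⋆[lsmul ℝ ℝ, volume] (fderiv ℝ g)) x) x := by
    intro k x
    refine (hasFDerivAt_integral_of_dominated_loc_of_lip (μ := volume) (s := Set.univ)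
      (F := fun x t => (lsmul ℝ ℝ) ((ρ k).normed volume t) (g (x - t)))
      (F' := fun t => (lsmul ℝ ℝ) ((ρ k).normed volume t) (fderiv ℝ g (x - t)))
      (bound := fun t => (ρ k).normed volume t * K) Filter.univ_mem ?_ ?_ ?_ ?_ ?_ ?_).2
    · refine Eventually.of_forall fun y => Continuous.aestronglyMeasurable ?_
      have := (ρ k).continuous_normed (μ := volume)
      have := hg.continuous
      simp only [lsmul_apply]
      fun_prop
    · have h1 : Continuous (fun t => (lsmul ℝ ℝ) ((ρ k).normed volume t) (g (x - t))) := by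
        have := (ρ k).continuous_normed (μ := volume)
        have := hg.continuous
        simp only [lsmul_apply]
        fun_prop
      refine h1.integrable_of_hasCompactSupport ?_
      simp only [lsmul_apply]
      exact ((ρ k).hasCompactSupport_normed (μ := volume)).smul_right
    · simp only [lsmul_apply]
      refine AEStronglyMeasurable.smul
        ((ρ k).continuous_normed (μ := volume)).aestronglyMeasurable ?_
      exact (hmeas.comp (measurable_const.sub measurable_id)).aestronglyMeasurable
    · refine Eventually.of_forall fun t => ?_
      rw [lipschitzOnWith_univ]
      refine LipschitzWith.of_dist_le_mul fun a b => ?_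
      have h0 := (ρ k).nonneg_normed (μ := volume) t
      have h1 := hg.dist_le_mul (a - t) (b - t)
      rw [dist_sub_right] at h1
      simp only [lsmul_apply, Real.coe_nnabs]
      rw [dist_smul₀, Real.norm_of_nonneg h0, abs_of_nonneg (mul_nonneg h0 K.coe_nonneg), mul_assoc]
      gcongr
    · exact ((ρ k).integrable_normed).mul_const _
    · have h1 : ∀ᵐ y, DifferentiableAt ℝ g y := hg.ae_differentiableAt
      have h2 := (Measure.measurePreserving_sub_left volume x).quasiMeasurePreserving.ae h1
      filter_upwards [h2] with t ht
      have h3 : HasFDerivAt (fun y => g (y - t)) (fderiv ℝ g (x - t)) x := by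
        have := ht.hasFDerivAt.comp x ((hasFDerivAt_id x).sub_const t)
        rw [ContinuousLinearMap.comp_id] at this
        exact this
      exact h3.const_smul _
  refine ⟨fun k => (ρ k).normed volume ⋆[lsmul ℝ ℝ, volume] g, R + 2, M, ?_, ?_, ?_, ?_, ?_, ?_⟩
  · intro k
    exact (ρ k).hasCompactSupport_normed.contDiff_convolution_left _ (ρ k).contDiff_normed
      hg.continuous.locallyIntegrable
  · intro k
    refine closure_minimal ?_ Metric.isClosed_closedBall
    refine (support_convolution_subset (L := lsmul ℝ ℝ)).trans ?_
    rintro _ ⟨a, ha, b, hb, rfl⟩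
    rw [(ρ k).support_normed_eq] at ha
    have hb' := hR (subset_tsupport _ hb)
    rw [mem_ball_zero_iff] at ha
    rw [mem_closedBall_zero_iff] at hb' ⊢
    have := norm_add_le a b
    have := hrho2 k
    simp only at *
    linarith
  · intro k x
    beta_reduce
    rw [convolution_def]
    have := norm_integral_le_of_norm_le (μ := volume)
      (f := fun t => (lsmul ℝ ℝ) ((ρ k).normed volume t) (g (x - t)))
      (g := fun t => (ρ k).normed volume t * M) ((ρ k).integrable_normed.mul_const _)
      (Eventually.of_forall fun t => by
        have h0 := (ρ k).nonneg_normed (μ := volume) t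
        simp only [lsmul_apply]
        rw [norm_smul, Real.norm_of_nonneg h0]
        exact mul_le_mul_of_nonneg_left (hM _) h0)
    rwa [integral_mul_const, (ρ k).integral_normed, one_mul] at this
  · intro k x
    rw [(hder k x).fderiv, convolution_def]
    have := norm_integral_le_of_norm_le (μ := volume)
      (f := fun t => (lsmul ℝ ℝ) ((ρ k).normed volume t) (fderiv ℝ g (x - t)))
      (g := fun t => (ρ k).normed volume t * K) ((ρ k).integrable_normed.mul_const _)
      (Eventually.of_forall fun t => by
        have h0 := (ρ k).nonneg_normed (μ := volume) t
        simp only [lsmul_apply]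
        rw [norm_smul, Real.norm_of_nonneg h0]
        exact mul_le_mul_of_nonneg_left (hbd _) h0)
    rwa [integral_mul_const, (ρ k).integral_normed, one_mul] at this
  · intro x
    exact ContDiffBump.convolution_tendsto_right_of_continuous hρ hg.continuous x
  · have hli : LocallyIntegrable (fderiv ℝ g) volume := by
      refine MeasureTheory.LocallyIntegrable.mono (f := fun _ => (K : ℝ)) (locallyIntegrable_const _)
        hmeas.aestronglyMeasurable (Eventually.of_forall fun x => ?_)
      simpa using hbd x
    have := ContDiffBump.ae_convolution_tendsto_right_of_locallyIntegrable (K := 2) (μ := volume) hρ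
      (Eventually.of_forall fun k => by
        change 2 / ((k : ℝ) + 1) ≤ 2 * (1 / ((k : ℝ) + 1))
        rw [mul_one_div]) hli
    filter_upwards [this] with x hx
    refine hx.congr fun k => ?_
    exact ((hder k x).fderiv).symm

open Filter Topology in
/-- bound for composite integrands -/
lemma sz_bound {n : ℕ}
    (Φ : EuclideanSpace ℝ (Fin n) → ℝ → (EuclideanSpace ℝ (Fin n) →L[ℝ] ℝ) → ℝ)
    (hΦ : Continuous fun p : EuclideanSpace ℝ (Fin n) × ℝ × (EuclideanSpace ℝ (Fin n) →L[ℝ] ℝ) =>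
      Φ p.1 p.2.1 p.2.2) (R M K : ℝ) :
    ∃ C, ∀ x ∈ Metric.closedBall 0 R, ∀ s, ‖s‖ ≤ M → ∀ p, ‖p‖ ≤ K → ‖Φ x s p‖ ≤ C := by
  obtain ⟨C, hC⟩ := ((isCompact_closedBall (0 : EuclideanSpace ℝ (Fin n)) R).prod
    ((isCompact_closedBall (0 : ℝ) M).prod
      (isCompact_closedBall (0 : EuclideanSpace ℝ (Fin n) →L[ℝ] ℝ) K))).exists_bound_of_continuousOn
        hΦ.continuousOn
  refine ⟨C, fun x hx s hs p hp => hC (x, s, p) ⟨hx, ?_, ?_⟩⟩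
  · simpa using hs
  · simpa using hp

lemma sz_fderiv_zero {n : ℕ} {g : EuclideanSpace ℝ (Fin n) → ℝ} {S : Set (EuclideanSpace ℝ (Fin n))}
    (h : tsupport g ⊆ S) {x} (hx : x ∉ S) : g x = 0 ∧ fderiv ℝ g x = 0 :=
  ⟨image_eq_zero_of_notMem_tsupport fun h' => hx (h h'),
    image_eq_zero_of_notMem_tsupport fun h' => hx (h (tsupport_fderiv_subset ℝ h'))⟩

open Filter Topology in
lemma sz_integrable {n : ℕ} {g : EuclideanSpace ℝ (Fin n) → ℝ} {K : NNReal}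
    (hg : LipschitzWith K g) (hs : HasCompactSupport g)
    (Φ : EuclideanSpace ℝ (Fin n) → ℝ → (EuclideanSpace ℝ (Fin n) →L[ℝ] ℝ) → ℝ)
    (hΦ : Continuous fun p : EuclideanSpace ℝ (Fin n) × ℝ × (EuclideanSpace ℝ (Fin n) →L[ℝ] ℝ) =>
      Φ p.1 p.2.1 p.2.2) (h0 : ∀ x, Φ x 0 0 = 0) :
    Integrable fun x => Φ x (g x) (fderiv ℝ g x) := by
  obtain ⟨R, hR⟩ := hs.isCompact.isBounded.subset_closedBall 0
  obtain ⟨M, hM⟩ := hs.exists_bound_of_continuous hg.continuous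
  obtain ⟨C, hC⟩ := sz_bound Φ hΦ R M K
  have hi : Integrable (Set.indicator (Metric.closedBall (0 : EuclideanSpace ℝ (Fin n)) R)
      fun _ => C) := by
    rw [integrable_indicator_iff measurableSet_closedBall]
    exact integrableOn_const (by exact (measure_closedBall_lt_top).ne)
  refine hi.mono' ?_ (Eventually.of_forall fun x => ?_)
  · have := hΦ.measurable.comp (measurable_id.prodMk
      (hg.continuous.measurable.prodMk (measurable_fderiv ℝ g)))
    exact this.aestronglyMeasurable
  · by_cases hx : x ∈ Metric.closedBall (0 : EuclideanSpace ℝ (Fin n)) R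
    · rw [Set.indicator_of_mem hx]
      exact hC x hx _ (hM x) _ (norm_fderiv_le_of_lipschitz ℝ hg)
    · rw [Set.indicator_of_notMem hx]
      obtain ⟨h1, h2⟩ := sz_fderiv_zero hR hx
      rw [h1, h2, h0, norm_zero]

open Filter Topology in
/-- Passing to the limit in integrals along smooth approximations of a Lipschitz function. -/
lemma sz_limit {n : ℕ} {g : EuclideanSpace ℝ (Fin n) → ℝ} {K : NNReal}
    (hg : LipschitzWith K g) (hs : HasCompactSupport g)  :
    ∃ (G : ℕ → EuclideanSpace ℝ (Fin n) → ℝ),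
      (∀ k, ContDiff ℝ (⊤ : ℕ∞) (G k)) ∧ (∀ k, HasCompactSupport (G k)) ∧
      ∀ (Φ : EuclideanSpace ℝ (Fin n) → ℝ → (EuclideanSpace ℝ (Fin n) →L[ℝ] ℝ) → ℝ)
      (_ : Continuous fun p : EuclideanSpace ℝ (Fin n) × ℝ × (EuclideanSpace ℝ (Fin n) →L[ℝ] ℝ) =>
      Φ p.1 p.2.1 p.2.2) (_ : ∀ x, Φ x 0 0 = 0),
      Tendsto (fun k => ∫ x, Φ x (G k x) (fderiv ℝ (G k) x)) atTop
        (𝓝 (∫ x, Φ x (g x) (fderiv ℝ g x))) := by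
  obtain ⟨G, R, M, hG1, hG2, hG3, hG4, hG5, hG6⟩ := sz_approx hg hs
  refine ⟨G, hG1, fun k => (isCompact_closedBall 0 R).of_isClosed_subset
    (isClosed_tsupport _) (hG2 k), fun Φ hΦ h0 => ?_⟩
  obtain ⟨C, hC⟩ := sz_bound Φ hΦ R M K
  have hi : Integrable (Set.indicator (Metric.closedBall (0 : EuclideanSpace ℝ (Fin n)) R)
      fun _ => C) := by
    rw [integrable_indicator_iff measurableSet_closedBall]
    exact integrableOn_const (by exact (measure_closedBall_lt_top).ne)
  refine tendsto_integral_of_dominated_convergence _ (fun k => ?_) hi (fun k => ?_) ?_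
  · have := hΦ.measurable.comp (measurable_id.prodMk
      ((hG1 k).continuous.measurable.prodMk (measurable_fderiv ℝ (G k))))
    exact this.aestronglyMeasurable
  · refine Eventually.of_forall fun x => ?_
    by_cases hx : x ∈ Metric.closedBall (0 : EuclideanSpace ℝ (Fin n)) R
    · rw [Set.indicator_of_mem hx]
      exact hC x hx _ (hG3 k x) _ (hG4 k x)
    · rw [Set.indicator_of_notMem hx]
      obtain ⟨h1, h2⟩ := sz_fderiv_zero (hG2 k) hx
      rw [h1, h2, h0, norm_zero]
  · filter_upwards [hG6] with x hx
    exact (hΦ.tendsto (x, g x, fderiv ℝ g x)).comp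
      (tendsto_const_nhds.prodMk_nhds ((hG5 x).prodMk_nhds hx))

/-- A `C¹` function times a compactly supported Lipschitz function is Lipschitz. -/
lemma sz_lip_mul {n : ℕ} {g h : EuclideanSpace ℝ (Fin n) → ℝ} {K : NNReal}
    (hg : LipschitzWith K g) (hs : HasCompactSupport g) (hh : ContDiff ℝ 1 h) :
    ∃ L, LipschitzWith L (fun x => h x * g x) := by
  obtain ⟨R, hR⟩ := hs.isCompact.isBounded.subset_closedBall 0
  obtain ⟨M, hM⟩ := hs.exists_bound_of_continuous hg.continuous
  let χ : ContDiffBump (0 : EuclideanSpace ℝ (Fin n)) :=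
    ⟨|R| + 1, |R| + 2, by positivity, by linarith⟩
  have hc : HasCompactSupport (fun x => h x * χ x) := χ.hasCompactSupport.mul_left
  have hd : ContDiff ℝ 1 (fun x => h x * χ x) := hh.mul χ.contDiff
  obtain ⟨A, hA⟩ := hd.lipschitzWith_of_hasCompactSupport hc (by simp)
  obtain ⟨B, hB⟩ := hc.exists_bound_of_continuous hd.continuous
  have heq : ∀ x, h x * g x = h x * χ x * g x := by
    intro x
    by_cases hx : x ∈ Metric.closedBall (0 : EuclideanSpace ℝ (Fin n)) R
    · rw [χ.one_of_mem_closedBall, mul_one]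
      refine Metric.closedBall_subset_closedBall ?_ hx
      have := le_abs_self R
      change R ≤ |R| + 1
      linarith
    · rw [(sz_fderiv_zero hR hx).1]; simp
  have hB0 : 0 ≤ B := (norm_nonneg _).trans (hB 0)
  have hM0 : 0 ≤ M := (norm_nonneg _).trans (hM 0)
  refine ⟨B.toNNReal * K + M.toNNReal * A, LipschitzWith.of_dist_le_mul fun x y => ?_⟩
  rw [heq x, heq y]
  have h1 := hg.dist_le_mul x y
  have h2 := hA.dist_le_mul x y
  rw [Real.dist_eq] at *
  have e : h x * χ x * g x - h y * χ y * g y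
    = h x * χ x * (g x - g y) + g y * (h x * χ x - h y * χ y) := by ring
  rw [e]
  refine (abs_add_le _ _).trans ?_
  rw [abs_mul (h x * χ x), abs_mul (g y)]
  have h3 := hB x
  have h4 := hM y
  rw [Real.norm_eq_abs] at h3 h4
  rw [NNReal.coe_add, NNReal.coe_mul, NNReal.coe_mul, Real.coe_toNNReal _ hB0,
    Real.coe_toNNReal _ hM0, add_mul, mul_assoc B, mul_assoc M]
  exact add_le_add (mul_le_mul h3 h1 (abs_nonneg _) hB0) (mul_le_mul h4 h2 (abs_nonneg _) hM0)

lemma sz_grad_sq {n : ℕ} (g : EuclideanSpace ℝ (Fin n) → ℝ) (x : EuclideanSpace ℝ (Fin n)) :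
    ‖gradient g x‖ ^ 2 = ∑ j, (fderiv ℝ g x (EuclideanSpace.single j 1)) ^ 2 := by
  rw [EuclideanSpace.real_norm_sq_eq]
  refine Finset.sum_congr rfl fun j _ => ?_
  congr 1
  have h : inner ℝ (gradient g x) (EuclideanSpace.single j (1 : ℝ))
      = fderiv ℝ g x (EuclideanSpace.single j 1) := by
    rw [gradient, InnerProductSpace.toDual_symm_apply]
  rw [← h, EuclideanSpace.inner_single_right]
  simp

/-- Integration by parts. -/
lemma sz_ibp {n : ℕ} {a b : EuclideanSpace ℝ (Fin n) → ℝ} (ha : ContDiff ℝ 1 a)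
    (hb : ContDiff ℝ 1 b) (hs : HasCompactSupport b) (v : EuclideanSpace ℝ (Fin n)) :
    ∫ x, a x * fderiv ℝ b x v = - ∫ x, fderiv ℝ a x v * b x := by
  have ha' : Continuous fun x => fderiv ℝ a x v :=
    (ha.continuous_fderiv (by simp)).clm_apply continuous_const
  have hb' : Continuous fun x => fderiv ℝ b x v :=
    (hb.continuous_fderiv (by simp)).clm_apply continuous_const
  apply integral_mul_fderiv_eq_neg_fderiv_mul_of_integrable
  · exact (ha'.mul hb.continuous).integrable_of_hasCompactSupport hs.mul_left
  · exact (ha.continuous.mul hb').integrable_of_hasCompactSupport (hs.fderiv_apply ℝ v).mul_left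
  · exact (ha.continuous.mul hb.continuous).integrable_of_hasCompactSupport hs.mul_left
  · exact fun x _ => (ha.differentiable (by simp)).differentiableAt
  · exact fun x _ => (hb.differentiable (by simp)).differentiableAt

lemma sz_symm {n : ℕ} {u : EuclideanSpace ℝ (Fin n) → ℝ} (hu : ContDiff ℝ 2 u)
    (x v w : EuclideanSpace ℝ (Fin n)) :
    fderiv ℝ (fun y => fderiv ℝ u y v) x w = fderiv ℝ (fun y => fderiv ℝ u y w) x v := by
  have hd : DifferentiableAt ℝ (fderiv ℝ u) x :=
    ((hu.fderiv_right (m := 1) (by norm_num)).differentiable (by simp)).differentiableAt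
  have h : IsSymmSndFDerivAt ℝ u x := hu.contDiffAt.isSymmSndFDerivAt (by simp)
  have e : ∀ v w, fderiv ℝ (fun y => fderiv ℝ u y v) x w = fderiv ℝ (fderiv ℝ u) x w v := by
    intro v w
    rw [fderiv_clm_apply hd (differentiableAt_const v)]
    simp
  rw [e, e]
  exact h w v

lemma sz_contDiff_dir {n : ℕ} {u : EuclideanSpace ℝ (Fin n) → ℝ} (hu : ContDiff ℝ 2 u)
    (v : EuclideanSpace ℝ (Fin n)) : ContDiff ℝ 1 (fun y => fderiv ℝ u y v) :=
  (hu.fderiv_right (m := 1) (by norm_num)).clm_apply contDiff_const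

lemma sz_cont_hess {n : ℕ} {u : EuclideanSpace ℝ (Fin n) → ℝ} (hu : ContDiff ℝ 2 u)
    (i j : Fin n) : Continuous (fun x => hessEntry u x i j) :=
  ((sz_contDiff_dir hu _).continuous_fderiv (by simp)).clm_apply continuous_const

/-- Differentiated equation, weak form, smooth test functions. -/
lemma sz_weak_smooth {n : ℕ} {f : ℝ → ℝ} (hf : ContDiff ℝ 1 f)
    {u : EuclideanSpace ℝ (Fin n) → ℝ} (hu : ContDiff ℝ 2 u)
    (hsol : ∀ x, -lap u x = f (u x)) {η : EuclideanSpace ℝ (Fin n) → ℝ}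
    (hη : ContDiff ℝ (⊤ : ℕ∞) η) (hs : HasCompactSupport η) (i : Fin n) :
    ∫ x, ((∑ j, hessEntry u x j i * fderiv ℝ η x (EuclideanSpace.single j 1))
      - deriv f (u x) * fderiv ℝ u x (EuclideanSpace.single i 1) * η x) = 0 := by
  have hη2 : ContDiff ℝ 2 η := contDiff_infty.1 hη 2
  have hη1 : ContDiff ℝ 1 η := hη.of_le (by exact_mod_cast le_top)
  have hu1 : ContDiff ℝ 1 u := hu.of_le (by norm_num)
  have hDη : ∀ v, Continuous fun x => fderiv ℝ η x v := fun v => (sz_contDiff_dir hη2 v).continuous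
  have hfu : ContDiff ℝ 1 (fun x => f (u x)) := hf.comp hu1
  have hderiv : ∀ x, fderiv ℝ (fun x => f (u x)) x (EuclideanSpace.single i 1)
      = deriv f (u x) * fderiv ℝ u x (EuclideanSpace.single i 1) := by
    intro x
    have h1 : HasDerivAt f (deriv f (u x)) (u x) :=
      ((hf.differentiable (by simp)) (u x)).hasDerivAt
    have h2 : HasFDerivAt u (fderiv ℝ u x) x := ((hu1.differentiable (by simp)) x).hasFDerivAt
    have := (h1.comp_hasFDerivAt x h2).fderiv
    have e : fderiv ℝ (fun x => f (u x)) x = deriv f (u x) • fderiv ℝ u x := this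
    rw [e]; simp
  have hint1 : ∀ j, Integrable fun x =>
      hessEntry u x j i * fderiv ℝ η x (EuclideanSpace.single j 1) := fun j =>
    ((sz_cont_hess hu j i).mul (hDη _)).integrable_of_hasCompactSupport
      (hs.fderiv_apply ℝ _).mul_left
  have hint2 : ∀ j, Integrable fun x =>
      hessEntry u x j j * fderiv ℝ η x (EuclideanSpace.single i 1) := fun j =>
    ((sz_cont_hess hu j j).mul (hDη _)).integrable_of_hasCompactSupport
      (hs.fderiv_apply ℝ _).mul_left
  have hint3 : Integrable fun x =>
      deriv f (u x) * fderiv ℝ u x (EuclideanSpace.single i 1) * η x := by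
    have h1 : Continuous (deriv f) := hf.continuous_deriv (by simp)
    exact (((h1.comp hu.continuous).mul (sz_contDiff_dir hu _).continuous).mul
      hη.continuous).integrable_of_hasCompactSupport hs.mul_left
  have key : ∀ j, ∫ x, hessEntry u x j i * fderiv ℝ η x (EuclideanSpace.single j 1)
      = ∫ x, hessEntry u x j j * fderiv ℝ η x (EuclideanSpace.single i 1) := by
    intro j
    have h1 := sz_ibp (sz_contDiff_dir hu (EuclideanSpace.single j 1))
      (sz_contDiff_dir hη2 (EuclideanSpace.single j 1)) (hs.fderiv_apply ℝ _)
      (EuclideanSpace.single i 1)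
    have h2 := sz_ibp (sz_contDiff_dir hu (EuclideanSpace.single j 1))
      (sz_contDiff_dir hη2 (EuclideanSpace.single i 1)) (hs.fderiv_apply ℝ _)
      (EuclideanSpace.single j 1)
    have h3 : ∀ x, fderiv ℝ (fun y => fderiv ℝ η y (EuclideanSpace.single j 1)) x
        (EuclideanSpace.single i 1) = fderiv ℝ (fun y => fderiv ℝ η y (EuclideanSpace.single i 1)) x
        (EuclideanSpace.single j 1) := fun x => sz_symm hη2 x _ _
    simp_rw [h3] at h1
    rw [h1] at h2
    have h4 : ∀ x, hessEntry u x j i = fderiv ℝ (fun y => fderiv ℝ u y (EuclideanSpace.single j 1)) x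
        (EuclideanSpace.single i 1) := fun x => sz_symm hu x _ _
    simp_rw [h4]
    exact neg_injective h2
  rw [integral_sub (integrable_finsetSum _ fun j _ => hint1 j) hint3,
    integral_finsetSum _ fun j _ => hint1 j]
  simp_rw [key]
  rw [← integral_finsetSum _ fun j _ => hint2 j]
  have h5 : ∀ x, ∑ j, hessEntry u x j j * fderiv ℝ η x (EuclideanSpace.single i 1)
      = -(f (u x) * fderiv ℝ η x (EuclideanSpace.single i 1)) := by
    intro x
    rw [← Finset.sum_mul, ← hsol x, lap]; ring
  simp_rw [h5]
  rw [integral_neg, sz_ibp hfu hη1 hs, neg_neg, sub_eq_zero]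
  simp_rw [hderiv]

lemma sz_weak {n : ℕ} {f : ℝ → ℝ} (hf : ContDiff ℝ 1 f)
    {u : EuclideanSpace ℝ (Fin n) → ℝ} (hu : ContDiff ℝ 2 u)
    (hsol : ∀ x, -lap u x = f (u x)) {η : EuclideanSpace ℝ (Fin n) → ℝ} {K : NNReal}
    (hη : LipschitzWith K η) (hs : HasCompactSupport η) (i : Fin n) :
    (Integrable fun x => ((∑ j, hessEntry u x j i * fderiv ℝ η x (EuclideanSpace.single j 1))
      - deriv f (u x) * fderiv ℝ u x (EuclideanSpace.single i 1) * η x)) ∧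
    ∫ x, ((∑ j, hessEntry u x j i * fderiv ℝ η x (EuclideanSpace.single j 1))
      - deriv f (u x) * fderiv ℝ u x (EuclideanSpace.single i 1) * η x) = 0 := by
  let Φ : EuclideanSpace ℝ (Fin n) → ℝ → (EuclideanSpace ℝ (Fin n) →L[ℝ] ℝ) → ℝ := fun x s p =>
    (∑ j, hessEntry u x j i * p (EuclideanSpace.single j 1))
      - deriv f (u x) * fderiv ℝ u x (EuclideanSpace.single i 1) * s
  have hΦ : Continuous fun p : EuclideanSpace ℝ (Fin n) × ℝ ×
      (EuclideanSpace ℝ (Fin n) →L[ℝ] ℝ) => Φ p.1 p.2.1 p.2.2 := by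
    have h1 : Continuous (deriv f) := hf.continuous_deriv (by simp)
    have h2 := hu.continuous
    have h3 := (sz_contDiff_dir hu (EuclideanSpace.single i 1)).continuous
    have h4 := fun j => sz_cont_hess hu j i
    simp only [Φ]
    fun_prop
  have h0 : ∀ x, Φ x 0 0 = 0 := by intro x; simp [Φ]
  refine ⟨sz_integrable hη hs Φ hΦ h0, ?_⟩
  obtain ⟨G, hG1, hG2, hG3⟩ := sz_limit hη hs
  have h := hG3 Φ hΦ h0
  have hz : ∀ k, ∫ x, Φ x (G k x) (fderiv ℝ (G k) x) = 0 := fun k =>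
    sz_weak_smooth hf hu hsol (hG1 k) (hG2 k) i
  simp_rw [hz] at h
  exact tendsto_nhds_unique h tendsto_const_nhds

lemma sz_int_quad {n : ℕ} {f : ℝ → ℝ} (hf : ContDiff ℝ 1 f)
    {u : EuclideanSpace ℝ (Fin n) → ℝ} (hu : ContDiff ℝ 2 u)
    {ψ : EuclideanSpace ℝ (Fin n) → ℝ} {K : NNReal}
    (hψ : LipschitzWith K ψ) (hs : HasCompactSupport ψ) :
    (Integrable fun x => ((∑ j, (fderiv ℝ ψ x (EuclideanSpace.single j 1)) ^ 2)
      - deriv f (u x) * ψ x ^ 2)) ∧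
    ((∀ ψ : EuclideanSpace ℝ (Fin n) → ℝ, ContDiff ℝ (⊤ : ℕ∞) ψ → HasCompactSupport ψ →
      0 ≤ ∫ x, (‖gradient ψ x‖ ^ 2 - deriv f (u x) * ψ x ^ 2)) →
    0 ≤ ∫ x, ((∑ j, (fderiv ℝ ψ x (EuclideanSpace.single j 1)) ^ 2)
      - deriv f (u x) * ψ x ^ 2)) := by
  let Φ : EuclideanSpace ℝ (Fin n) → ℝ → (EuclideanSpace ℝ (Fin n) →L[ℝ] ℝ) → ℝ := fun x s p =>
    (∑ j, (p (EuclideanSpace.single j 1)) ^ 2) - deriv f (u x) * s ^ 2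
  have hΦ : Continuous fun p : EuclideanSpace ℝ (Fin n) × ℝ ×
      (EuclideanSpace ℝ (Fin n) →L[ℝ] ℝ) => Φ p.1 p.2.1 p.2.2 := by
    have h1 : Continuous (deriv f) := hf.continuous_deriv (by simp)
    have h2 := hu.continuous
    simp only [Φ]
    fun_prop
  have h0 : ∀ x, Φ x 0 0 = 0 := by intro x; simp [Φ]
  refine ⟨sz_integrable hψ hs Φ hΦ h0, fun hst => ?_⟩
  obtain ⟨G, hG1, hG2, hG3⟩ := sz_limit hψ hs
  refine ge_of_tendsto' (hG3 Φ hΦ h0) fun k => ?_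
  have := hst (G k) (hG1 k) (hG2 k)
  simp_rw [sz_grad_sq] at this
  exact this

/-- derivative of the regularised norm of the gradient -/
lemma sz_deriv_w {n : ℕ} {u : EuclideanSpace ℝ (Fin n) → ℝ} (hu : ContDiff ℝ 2 u) (δ : ℝ)
    (x : EuclideanSpace ℝ (Fin n))
    (hx : (∑ i, (fderiv ℝ u x (EuclideanSpace.single i 1)) ^ 2) + δ ≠ 0) (j : Fin n) :
    fderiv ℝ (fun y => √((∑ i, (fderiv ℝ u y (EuclideanSpace.single i 1)) ^ 2) + δ)) x
      (EuclideanSpace.single j 1) =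
    (∑ i, fderiv ℝ u x (EuclideanSpace.single i 1) * hessEntry u x j i) /
      √((∑ i, (fderiv ℝ u x (EuclideanSpace.single i 1)) ^ 2) + δ) := by
  have h1 : ∀ i ∈ Finset.univ, HasFDerivAt
      (fun y => (fderiv ℝ u y (EuclideanSpace.single i 1)) ^ 2) _ x := fun i _ =>
    (((sz_contDiff_dir hu (EuclideanSpace.single i 1)).differentiable
      (by simp)).differentiableAt (x := x)).hasFDerivAt.pow 2
  have h2 := ((HasFDerivAt.fun_sum h1).add_const δ).sqrt hx
  rw [h2.fderiv]
  simp only [smul_apply, sum_apply, smul_eq_mul, hessEntry]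
  rw [Finset.mul_sum, Finset.sum_div]
  refine Finset.sum_congr rfl fun i _ => ?_
  simp
  field_simp

lemma sz_pointwise {n : ℕ} {u : EuclideanSpace ℝ (Fin n) → ℝ} (hu : ContDiff ℝ 2 u) {δ : ℝ}
    (hδ : 0 < δ) (x : EuclideanSpace ℝ (Fin n)) :
    SZ u x ≤ hessNormSq u x - ∑ j, (fderiv ℝ (fun y =>
      √((∑ i, (fderiv ℝ u y (EuclideanSpace.single i 1)) ^ 2) + δ)) x
        (EuclideanSpace.single j 1)) ^ 2 := by
  have hnn : 0 ≤ ∑ i, (fderiv ℝ u x (EuclideanSpace.single i 1)) ^ 2 := by positivity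
  rw [SZ]
  refine sub_le_sub_left ?_ _
  simp_rw [sz_deriv_w hu δ x (by positivity)]
  by_cases h : gradient u x = 0
  · rw [if_pos h]
    have h1 := sz_grad_sq u x
    rw [h] at h1
    have h2 : ∀ i, fderiv ℝ u x (EuclideanSpace.single i 1) = 0 := by
      intro i
      have h3 : ∑ i, (fderiv ℝ u x (EuclideanSpace.single i 1)) ^ 2 = 0 := by
        rw [← h1]; simp
      rw [Finset.sum_eq_zero_iff_of_nonneg (fun _ _ => sq_nonneg _)] at h3
      simpa using h3 i (Finset.mem_univ i)
    simp [h2]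
  · rw [if_neg h, gradNormGradSq, sz_grad_sq]
    have hw : (fun y => ‖gradient u y‖)
        = fun y => √((∑ i, (fderiv ℝ u y (EuclideanSpace.single i 1)) ^ 2) + 0) := by
      funext y
      rw [add_zero, ← sz_grad_sq, Real.sqrt_sq (norm_nonneg _)]
    have hpos : 0 < ∑ i, (fderiv ℝ u x (EuclideanSpace.single i 1)) ^ 2 := by
      rw [← sz_grad_sq]
      have := norm_pos_iff.2 h
      positivity
    rw [hw]
    refine Finset.sum_le_sum fun j _ => ?_
    rw [sz_deriv_w hu 0 x (by rw [add_zero]; exact hpos.ne')]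
    rw [div_pow, div_pow, Real.sq_sqrt (by positivity), Real.sq_sqrt (by positivity), add_zero]
    gcongr
    linarith

lemma sz_algebra {n : ℕ} (H : Fin n → Fin n → ℝ) (v p q : Fin n → ℝ) (a s c δ : ℝ)
    (h1 : ∀ j, a * q j = ∑ i, v i * H j i) (h2 : a ^ 2 = (∑ i, v i ^ 2) + δ) :
    ((∑ j, (a * p j + s * q j) ^ 2) - c * (a * s) ^ 2)
      - ∑ i, ((∑ j, H j i * (v i * (2 * s * p j) + s ^ 2 * H j i)) - c * v i * (v i * s ^ 2))
    = (∑ i, v i ^ 2) * (∑ j, p j ^ 2) + δ * ((∑ j, p j ^ 2) - c * s ^ 2)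
      - ((∑ i, ∑ j, H i j ^ 2) - ∑ j, q j ^ 2) * s ^ 2 := by
  have e1 : ∑ i, ((∑ j, H j i * (v i * (2 * s * p j) + s ^ 2 * H j i)) - c * v i * (v i * s ^ 2))
      = (∑ j, 2 * s * p j * (a * q j)) + s ^ 2 * (∑ i, ∑ j, H i j ^ 2)
        - c * s ^ 2 * ∑ i, v i ^ 2 := by
    rw [Finset.sum_sub_distrib, Finset.sum_comm, Finset.mul_sum, Finset.mul_sum,
      ← Finset.sum_add_distrib]
    congr 1
    · refine Finset.sum_congr rfl fun j _ => ?_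
      rw [h1, Finset.mul_sum, Finset.mul_sum, ← Finset.sum_add_distrib]
      exact Finset.sum_congr rfl fun i _ => by ring
    · exact Finset.sum_congr rfl fun i _ => by ring
  have e2 : ∑ j, (a * p j + s * q j) ^ 2 = a ^ 2 * (∑ j, p j ^ 2) + (∑ j, 2 * s * p j * (a * q j))
      + s ^ 2 * ∑ j, q j ^ 2 := by
    rw [Finset.mul_sum, Finset.mul_sum, ← Finset.sum_add_distrib, ← Finset.sum_add_distrib]
    exact Finset.sum_congr rfl fun j _ => by ring
  rw [e1, e2, mul_pow, h2]
  ring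

lemma sz_main {n : ℕ} (f : ℝ → ℝ) (hf : ContDiff ℝ 1 f)
    (u : EuclideanSpace ℝ (Fin n) → ℝ) (hu : ContDiff ℝ 2 u)
    (hsol : IsStableSolution f u)
    (φ : EuclideanSpace ℝ (Fin n) → ℝ) (K : NNReal) (hφ : LipschitzWith K φ)
    (hsupp : HasCompactSupport φ) (hint : Integrable fun x => SZ u x * φ x ^ 2)
    {δ : ℝ} (hδ : 0 < δ) :
    ∫ x, SZ u x * φ x ^ 2 ≤ (∫ x, ‖gradient u x‖ ^ 2 * ‖gradient φ x‖ ^ 2)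
      + δ * ∫ x, ((∑ j, (fderiv ℝ φ x (EuclideanSpace.single j 1)) ^ 2)
      - deriv f (u x) * φ x ^ 2) := by
  set w : EuclideanSpace ℝ (Fin n) → ℝ := fun y =>
    √((∑ i, (fderiv ℝ u y (EuclideanSpace.single i 1)) ^ 2) + δ) with hwdef
  have hv : ∀ i : Fin n, ContDiff ℝ 1 fun y => fderiv ℝ u y (EuclideanSpace.single i 1) :=
    fun i => sz_contDiff_dir hu _
  have hpos : ∀ x, 0 < (∑ i, (fderiv ℝ u x (EuclideanSpace.single i 1)) ^ 2) + δ :=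
    fun x => by positivity
  have hw : ContDiff ℝ 1 w :=
    ((ContDiff.sum fun i _ => (hv i).pow 2).add contDiff_const).sqrt fun x => (hpos x).ne'
  obtain ⟨L1, hL1⟩ := sz_lip_mul hφ hsupp hw
  have hs1 : HasCompactSupport fun x => w x * φ x := hsupp.mul_left
  have hη : ∀ i : Fin n, ∃ L, LipschitzWith L
      fun x => fderiv ℝ u x (EuclideanSpace.single i 1) * φ x ^ 2 := by
    obtain ⟨L2, hL2⟩ : ∃ L, LipschitzWith L fun x => φ x ^ 2 := by
      obtain ⟨M, hM⟩ := hsupp.exists_bound_of_continuous hφ.continuous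
      refine ⟨2 * M.toNNReal * K, LipschitzWith.of_dist_le_mul fun x y => ?_⟩
      have hM0 : 0 ≤ M := (norm_nonneg _).trans (hM 0)
      rw [NNReal.coe_mul, NNReal.coe_mul, Real.coe_toNNReal _ hM0, Real.dist_eq]
      have h1 := hφ.dist_le_mul x y
      rw [Real.dist_eq] at h1
      have e : φ x ^ 2 - φ y ^ 2 = (φ x + φ y) * (φ x - φ y) := by ring
      have h3 : |φ x + φ y| ≤ 2 * M := by
        have := abs_add_le (φ x) (φ y)
        have h4 := hM x
        have h5 := hM y
        rw [Real.norm_eq_abs] at h4 h5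
        linarith
      rw [e, abs_mul, mul_assoc]
      exact mul_le_mul h3 h1 (abs_nonneg _) (by positivity)
    intro i
    have hc2 : HasCompactSupport fun x => φ x ^ 2 := by
      simp_rw [pow_two]; exact hsupp.mul_left
    exact sz_lip_mul hL2 hc2 (hv i)
  have hs2 : ∀ i : Fin n, HasCompactSupport
      fun x => fderiv ℝ u x (EuclideanSpace.single i 1) * φ x ^ 2 := by
    intro i
    have hc2 : HasCompactSupport fun x => φ x ^ 2 := by
      simp_rw [pow_two]; exact hsupp.mul_left
    exact hc2.mul_left
  choose L2 hL2 using hη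
  obtain ⟨hP1, hP2⟩ := sz_int_quad hf hu hL1 hs1
  have hP2 := hP2 hsol.2
  have hQ := fun i => sz_weak hf hu hsol.1 (hL2 i) (hs2 i) i
  obtain ⟨hB, -⟩ := sz_int_quad hf hu hφ hsupp
  have hA : Integrable fun x => ‖gradient u x‖ ^ 2 * ‖gradient φ x‖ ^ 2 := by
    simp_rw [sz_grad_sq]
    refine sz_integrable hφ hsupp (fun x s p =>
      (∑ j, (fderiv ℝ u x (EuclideanSpace.single j 1)) ^ 2)
        * (∑ j, (p (EuclideanSpace.single j 1)) ^ 2)) ?_ (by simp)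
    have := fun i => (hv i).continuous
    fun_prop
  have hT := hP1.sub (integrable_finsetSum Finset.univ fun i _ => (hQ i).1)
  have hT1 := integral_sub' hP1 (integrable_finsetSum Finset.univ fun i _ => (hQ i).1)
  rw [integral_finsetSum _ fun i _ => (hQ i).1, Finset.sum_congr rfl (fun i _ => (hQ i).2),
    Finset.sum_const_zero, sub_zero] at hT1
  have hTint := hP2.trans_eq hT1.symm
  have hAB := (hA.add (hB.const_mul δ))
  have hmono := integral_mono_ae hint (hAB.sub hT) ?_
  · rw [integral_sub' hAB hT, integral_add' hA (hB.const_mul δ), integral_const_mul] at hmono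
    refine hmono.trans (sub_le_self _ ?_)
    exact hTint
  · filter_upwards [hφ.ae_differentiableAt (μ := volume)] with x hx
    simp only [Pi.sub_apply, Pi.add_apply]
    have hwx : DifferentiableAt ℝ w x := (hw.differentiable (by simp)) x
    have d1 : ∀ j : Fin n, fderiv ℝ (fun x => w x * φ x) x (EuclideanSpace.single j 1)
        = w x * fderiv ℝ φ x (EuclideanSpace.single j 1)
          + φ x * fderiv ℝ w x (EuclideanSpace.single j 1) := by
      intro j
      rw [fderiv_fun_mul hwx hx]; simp
    have d2 : ∀ i j : Fin n, fderiv ℝ (fun x => fderiv ℝ u x (EuclideanSpace.single i 1) * φ x ^ 2) x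
        (EuclideanSpace.single j 1)
        = fderiv ℝ u x (EuclideanSpace.single i 1)
            * (2 * φ x * fderiv ℝ φ x (EuclideanSpace.single j 1))
          + φ x ^ 2 * hessEntry u x j i := by
      intro i j
      rw [fderiv_fun_mul (((hv i).differentiable (by simp)) x) (hx.fun_pow 2), fderiv_fun_pow 2 hx]
      simp [hessEntry]
    simp_rw [d1, d2]
    rw [sz_algebra (fun i j => hessEntry u x i j)
      (fun i => fderiv ℝ u x (EuclideanSpace.single i 1))
      (fun i => fderiv ℝ φ x (EuclideanSpace.single i 1))
      (fun i => fderiv ℝ w x (EuclideanSpace.single i 1)) (w x) (φ x) (deriv f (u x)) δ ?_ ?_]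
    · have h := sz_pointwise hu hδ x
      have h' := mul_le_mul_of_nonneg_right h (sq_nonneg (φ x))
      rw [sz_grad_sq, sz_grad_sq]
      rw [hessNormSq] at h'
      linarith
    · intro j
      rw [hwdef, sz_deriv_w hu δ x (hpos x).ne', mul_div_cancel₀]
      exact (Real.sqrt_pos.2 (hpos x)).ne'
    · exact Real.sq_sqrt (hpos x).le

theorem sternberg_zumbrun_inequality
    {n : ℕ} (f : ℝ → ℝ) (hf : ContDiff ℝ 1 f)
    (u : EuclideanSpace ℝ (Fin n) → ℝ) (hu : ContDiff ℝ 2 u)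
    (hsol : IsStableSolution f u)
    (φ : EuclideanSpace ℝ (Fin n) → ℝ) (K : NNReal) (hφ : LipschitzWith K φ)
    (hsupp : HasCompactSupport φ) :
    ∫ x, SZ u x * φ x ^ 2 ≤ ∫ x, ‖gradient u x‖ ^ 2 * ‖gradient φ x‖ ^ 2 := by
  by_cases hint : Integrable fun x => SZ u x * φ x ^ 2
  · set B := ∫ x, ((∑ j, (fderiv ℝ φ x (EuclideanSpace.single j 1)) ^ 2)
      - deriv f (u x) * φ x ^ 2) with hB
    refine le_of_forall_pos_le_add fun ε hε => ?_
    have h := sz_main f hf u hu hsol φ K hφ hsupp hint (δ := ε / (|B| + 1)) (by positivity)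
    rw [← hB] at h
    refine h.trans (add_le_add_right ?_ _)
    rw [div_mul_eq_mul_div, div_le_iff₀ (by positivity)]
    have := le_abs_self B
    nlinarith
  · rw [integral_undef hint]
    exact integral_nonneg fun x => by positivity
end

section
/- Let g : ℝ → ℝ be a bounded C² solution of g'' + f(g) = 0 (f ∈ C¹) that is stable, i.e. ∫_ℝ(ψ'² - f'(g)ψ²) ≥ 0 for all ψ ∈ C_c^∞(ℝ). If g is nonconstant, then g is strictly monotone (g' never vanishes). -/
open MeasureTheory

lemma aux_deriv_zero {ψ : ℝ → ℝ} {p r : ℝ} (hz : ∀ t, t ∉ Set.Icc p r → ψ t = 0) :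
    ∀ t, t ∉ Set.Icc p r → deriv ψ t = 0 := by
  intro t ht
  have h : ψ =ᶠ[nhds t] fun _ => (0:ℝ) := by
    filter_upwards [isClosed_Icc.isOpen_compl.mem_nhds ht] with s hs using hz s hs
  rw [h.deriv_eq]; simp

lemma aux_compact {ψ : ℝ → ℝ} {p r : ℝ} (hz : ∀ t, t ∉ Set.Icc p r → ψ t = 0) :
    HasCompactSupport ψ := HasCompactSupport.intro isCompact_Icc (fun t ht => hz t ht)

open scoped Convolution in
lemma aux_approx {ψ : ℝ → ℝ} (hψ : ContDiff ℝ 1 ψ) {p r : ℝ}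
    (hz : ∀ t, t ∉ Set.Icc p r → ψ t = 0) {ε : ℝ} (hε : 0 < ε) :
    ∃ χ : ℝ → ℝ, ContDiff ℝ (⊤ : ℕ∞) χ ∧ (∀ t, t ∉ Set.Icc (p-1) (r+1) → χ t = 0) ∧
      ∀ t, |χ t - ψ t| ≤ ε ∧ |deriv χ t - deriv ψ t| ≤ ε := by
  have hc := aux_compact hz
  have hc' := aux_compact (aux_deriv_zero hz)
  have hdc : Continuous (deriv ψ) := hψ.continuous_deriv le_rfl
  have u1 := hc.uniformContinuous_of_continuous hψ.continuous
  have u2 := hc'.uniformContinuous_of_continuous hdc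
  obtain ⟨d1, hd1, h1⟩ := Metric.uniformContinuous_iff.1 u1 ε hε
  obtain ⟨d2, hd2, h2⟩ := Metric.uniformContinuous_iff.1 u2 ε hε
  set d := min 1 (min d1 d2) with hd
  have hdpos : 0 < d := by positivity
  let b : ContDiffBump (0:ℝ) := ⟨d/2, d, by positivity, by linarith⟩
  have hbo : b.rOut = d := rfl
  have hder : ∀ t, HasDerivAt (b.normed volume ⋆[ContinuousLinearMap.lsmul ℝ ℝ, volume] ψ)
      ((b.normed volume ⋆[ContinuousLinearMap.lsmul ℝ ℝ, volume] deriv ψ) t) t := fun t =>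
    hc.hasDerivAt_convolution_right _ (b.continuous_normed.locallyIntegrable) hψ t
  refine ⟨b.normed volume ⋆[ContinuousLinearMap.lsmul ℝ ℝ, volume] ψ, ?_, ?_, ?_⟩
  · exact b.hasCompactSupport_normed.contDiff_convolution_left _ b.contDiff_normed
      hψ.continuous.locallyIntegrable
  · intro t ht
    by_contra hne
    apply ht
    obtain ⟨x, hx, y, hy, hxy⟩ := support_convolution_subset (ContinuousLinearMap.lsmul ℝ ℝ)
      (Function.mem_support.2 hne)
    rw [b.support_normed_eq, hbo] at hx
    have hy' : y ∈ Set.Icc p r := by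
      by_contra hh; exact hy (hz y hh)
    simp only [Metric.mem_ball, Real.dist_eq, sub_zero, abs_lt] at hx
    have : d ≤ 1 := min_le_left _ _
    simp only at hxy
    constructor <;> linarith [hy'.1, hy'.2, hx.1, hx.2]
  · intro t
    rw [(hder t).deriv]
    constructor
    · rw [← Real.dist_eq]
      refine b.dist_normed_convolution_le hψ.continuous.aestronglyMeasurable ?_
      intro x hx
      refine (h1 (lt_of_lt_of_le hx ?_)).le
      rw [hbo]; exact (min_le_right _ _).trans (min_le_left _ _)
    · rw [← Real.dist_eq]
      refine b.dist_normed_convolution_le hdc.aestronglyMeasurable ?_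
      intro x hx
      refine (h2 (lt_of_lt_of_le hx ?_)).le
      rw [hbo]; exact (min_le_right _ _).trans (min_le_right _ _)

lemma aux_stable {q : ℝ → ℝ} (hq : Continuous q)
    (hstable : ∀ ψ : ℝ → ℝ, ContDiff ℝ (⊤ : ℕ∞) ψ → HasCompactSupport ψ →
      0 ≤ ∫ t, ((deriv ψ t) ^ 2 - q t * ψ t ^ 2))
    {ψ : ℝ → ℝ} (hψ : ContDiff ℝ 1 ψ) {p r : ℝ}
    (hz : ∀ t, t ∉ Set.Icc p r → ψ t = 0) :
    0 ≤ ∫ t, ((deriv ψ t) ^ 2 - q t * ψ t ^ 2) := by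
  have hdc : Continuous (deriv ψ) := hψ.continuous_deriv le_rfl
  have key : ∀ n : ℕ, ∃ χ : ℝ → ℝ, ContDiff ℝ (⊤ : ℕ∞) χ ∧
      (∀ t, t ∉ Set.Icc (p-1) (r+1) → χ t = 0) ∧
      ∀ t, |χ t - ψ t| ≤ 1 / ((n:ℝ)+1) ∧ |deriv χ t - deriv ψ t| ≤ 1 / ((n:ℝ)+1) :=
    fun n => aux_approx hψ hz (by positivity)
  choose χ h1 h2 h3 using key
  obtain ⟨Cq, hCq⟩ := (isCompact_Icc (a := p-1) (b := r+1)).exists_bound_of_continuousOn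
    hq.continuousOn
  obtain ⟨C1, hC1⟩ := (isCompact_Icc (a := p-1) (b := r+1)).exists_bound_of_continuousOn
    hψ.continuous.continuousOn
  obtain ⟨C2, hC2⟩ := (isCompact_Icc (a := p-1) (b := r+1)).exists_bound_of_continuousOn
    hdc.continuousOn
  have hle : ∀ n : ℕ, 1 / ((n:ℝ)+1) ≤ 1 := fun n => by
    rw [div_le_one (by positivity)]; linarith [(Nat.cast_nonneg n : (0:ℝ) ≤ n)]
  have lim : Filter.Tendsto (fun n => ∫ t, ((deriv (χ n) t) ^ 2 - q t * χ n t ^ 2)) Filter.atTop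
      (nhds (∫ t, ((deriv ψ t) ^ 2 - q t * ψ t ^ 2))) := by
    refine tendsto_integral_of_dominated_convergence
      (Set.indicator (Set.Icc (p-1) (r+1)) fun _ => (C2+1)^2 + Cq * (C1+1)^2) ?_ ?_ ?_ ?_
    · intro n
      have := (h1 n).continuous
      have := (h1 n).continuous_deriv (by simp)
      exact Continuous.aestronglyMeasurable (by fun_prop)
    · rw [integrable_indicator_iff measurableSet_Icc]
      exact integrableOn_const (by simp)
    · intro n
      refine Filter.Eventually.of_forall fun t => ?_
      by_cases ht : t ∈ Set.Icc (p-1) (r+1)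
      · rw [Set.indicator_of_mem ht]
        have a1 := hCq t ht
        have a2 := hC1 t ht
        have a3 := hC2 t ht
        rw [Real.norm_eq_abs] at *
        have b1 := (h3 n t).1.trans (hle n)
        have b2 := (h3 n t).2.trans (hle n)
        have c1 : |χ n t| ≤ C1 + 1 := by
          have := abs_add_le (χ n t - ψ t) (ψ t); simp only [sub_add_cancel] at this; linarith
        have c2 : |deriv (χ n) t| ≤ C2 + 1 := by
          have := abs_add_le (deriv (χ n) t - deriv ψ t) (deriv ψ t)
          simp only [sub_add_cancel] at this; linarith
        refine (abs_sub _ _).trans ?_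
        rw [abs_mul, abs_pow, abs_pow]
        have := (abs_nonneg _).trans a1
        gcongr
      · rw [Set.indicator_of_notMem ht, h2 n t ht, aux_deriv_zero (h2 n) t ht]; simp
    · refine Filter.Eventually.of_forall fun t => ?_
      have l0 := tendsto_one_div_add_atTop_nhds_zero_nat (𝕜 := ℝ)
      have l1 : Filter.Tendsto (fun n => χ n t) Filter.atTop (nhds (ψ t)) := by
        rw [tendsto_iff_dist_tendsto_zero]
        exact squeeze_zero (fun _ => dist_nonneg) (fun n => (h3 n t).1) l0
      have l2 : Filter.Tendsto (fun n => deriv (χ n) t) Filter.atTop (nhds (deriv ψ t)) := by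
        rw [tendsto_iff_dist_tendsto_zero]
        exact squeeze_zero (fun _ => dist_nonneg) (fun n => (h3 n t).2) l0
      exact (l2.pow 2).sub ((l1.pow 2).const_mul _)
  exact ge_of_tendsto' lim fun n => hstable _ (h1 n) (aux_compact (h2 n))

lemma aux_identity {q φ φ' : ℝ → ℝ} (hq : Continuous q)
    (hstable : ∀ ψ : ℝ → ℝ, ContDiff ℝ (⊤ : ℕ∞) ψ → HasCompactSupport ψ →
      0 ≤ ∫ t, ((deriv ψ t) ^ 2 - q t * ψ t ^ 2))
    (hφ : ∀ t, HasDerivAt φ (φ' t) t) (hφ' : ∀ t, HasDerivAt φ' (-(q t * φ t)) t)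
    {η h η' h' : ℝ → ℝ} (hη : ∀ t, HasDerivAt η (η' t) t) (hh : ∀ t, HasDerivAt h (h' t) t)
    (cη : Continuous η') (ch : Continuous h') {p r : ℝ} (hpr : p ≤ r)
    (zη : ∀ t, t ∉ Set.Icc p r → η t = 0) (zh : ∀ t, t ∉ Set.Icc p r → h t = 0) (c : ℝ) :
    0 ≤ (∫ t in (p-1)..(r+1), (φ t ^ 2 * η' t ^ 2 + 2 * c * η' t * (φ t * h' t - φ' t * h t)))
      + c ^ 2 * ∫ t, (h' t ^ 2 - q t * h t ^ 2) := by
  have cφ : Continuous φ := continuous_iff_continuousAt.2 fun t => (hφ t).continuousAt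
  have cφ' : Continuous φ' := continuous_iff_continuousAt.2 fun t => (hφ' t).continuousAt
  have cη0 : Continuous η := continuous_iff_continuousAt.2 fun t => (hη t).continuousAt
  have ch0 : Continuous h := continuous_iff_continuousAt.2 fun t => (hh t).continuousAt
  have hψ : ∀ t, HasDerivAt (fun t => φ t * η t + c * h t)
      (φ' t * η t + φ t * η' t + c * h' t) t := fun t =>
    ((hφ t).mul (hη t)).add ((hh t).const_mul c)
  have dψ : deriv (fun t => φ t * η t + c * h t) =
      fun t => φ' t * η t + φ t * η' t + c * h' t := funext fun t => (hψ t).deriv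
  have hC1 : ContDiff ℝ 1 (fun t => φ t * η t + c * h t) := by
    rw [contDiff_one_iff_deriv]
    refine ⟨fun t => (hψ t).differentiableAt, ?_⟩
    rw [dψ]; fun_prop
  have hz : ∀ t, t ∉ Set.Icc p r → (fun t => φ t * η t + c * h t) t = 0 := fun t ht => by
    simp [zη t ht, zh t ht]
  have main := aux_stable hq hstable hC1 hz
  have sub : ∀ t, t ∉ Set.Ioc (p-1) (r+1) → t ∉ Set.Icc p r := fun t ht h => 
    ht ⟨by linarith [h.1], by linarith [h.2]⟩
  have dh : deriv h = h' := funext fun t => (hh t).deriv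
  rw [← intervalIntegral.integral_eq_integral_of_support_subset (a := p-1) (b := r+1)] at main
  swap
  · intro t ht
    by_contra hn
    apply ht
    simp only
    rw [aux_deriv_zero hz t (sub t hn)]
    simp [zη t (sub t hn), zh t (sub t hn)]
  rw [← intervalIntegral.integral_eq_integral_of_support_subset (a := p-1) (b := r+1)]
  swap
  · intro t ht
    by_contra hn
    apply ht
    simp only
    rw [← dh, aux_deriv_zero zh t (sub t hn)]
    simp [zh t (sub t hn)]
  have T : ∫ t in (p-1)..(r+1), ((φ' t * φ' t + φ t * (-(q t * φ t))) * η t ^ 2 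
      + φ t * φ' t * (2 * η t * η' t)
      + 2 * c * ((-(q t * φ t)) * (η t * h t) + φ' t * (η' t * h t + η t * h' t))) = 0 := by
    rw [intervalIntegral.integral_eq_sub_of_hasDerivAt
      (f := fun t => φ t * φ' t * η t ^ 2 + 2 * c * (φ' t * (η t * h t)))]
    · rw [zη (p-1) (fun h => by linarith [h.1]), zη (r+1) (fun h => by linarith [h.2])]
      simp
    · intro t _
      have hD := (((hφ t).mul (hφ' t)).mul ((hη t).pow 2)).add
        (((hφ' t).mul ((hη t).mul (hh t))).const_mul (2 * c))
      refine HasDerivAt.congr_deriv (f := fun t => φ t * φ' t * η t ^ 2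
        + 2 * c * (φ' t * (η t * h t))) hD ?_
      simp only [Pi.mul_apply, Pi.pow_apply]
      norm_num
    · exact Continuous.intervalIntegrable (by fun_prop) _ _
  rw [dψ] at main
  rw [← intervalIntegral.integral_const_mul]
  refine le_of_le_of_eq ?_ (add_zero _)
  rw [← T, ← intervalIntegral.integral_add, ← intervalIntegral.integral_add, T]
  · refine main.trans_eq (intervalIntegral.integral_congr fun t _ => ?_)
    simp only
    ring
  all_goals exact Continuous.intervalIntegrable (by fun_prop) _ _

lemma aux_S0 {x : ℝ} (hx : x ≤ 0) : deriv Real.smoothTransition x = 0 := by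
  apply IsLocalMin.deriv_eq_zero
  refine Filter.Eventually.of_forall fun y => ?_
  rw [Real.smoothTransition.zero_of_nonpos hx]; exact Real.smoothTransition.nonneg y

lemma aux_S1 {x : ℝ} (hx : 1 ≤ x) : deriv Real.smoothTransition x = 0 := by
  apply IsLocalMax.deriv_eq_zero
  refine Filter.Eventually.of_forall fun y => ?_
  rw [Real.smoothTransition.one_of_one_le hx]; exact Real.smoothTransition.le_one y

lemma aux_Sd (x : ℝ) : HasDerivAt Real.smoothTransition (deriv Real.smoothTransition x) x :=
  ((Real.smoothTransition.contDiff (n := 1)).differentiable (by simp) x).hasDerivAt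

lemma aux_Sc : Continuous (deriv Real.smoothTransition) :=
  (Real.smoothTransition.contDiff (n := 1)).continuous_deriv (by simp)

lemma aux_Sb : ∃ C : ℝ, ∀ x, |deriv Real.smoothTransition x| ≤ C := by
  obtain ⟨C, hC⟩ := (isCompact_Icc (a := (0:ℝ)) (b := 1)).exists_bound_of_continuousOn
    aux_Sc.continuousOn
  refine ⟨C, fun x => ?_⟩
  have h0 : 0 ≤ C := (norm_nonneg _).trans (hC 0 (by simp))
  rcases le_or_gt x 0 with h | h
  · rw [aux_S0 h]; simpa
  rcases le_or_gt 1 x with h1 | h1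
  · rw [aux_S1 h1]; simpa
  exact hC x ⟨h.le, h1.le⟩

set_option maxHeartbeats 1000000 in
lemma aux_core {q φ φ' : ℝ → ℝ} (hq : Continuous q)
    (hstable : ∀ ψ : ℝ → ℝ, ContDiff ℝ (⊤ : ℕ∞) ψ → HasCompactSupport ψ →
      0 ≤ ∫ t, ((deriv ψ t) ^ 2 - q t * ψ t ^ 2))
    (hφ : ∀ t, HasDerivAt φ (φ' t) t) (hφ' : ∀ t, HasDerivAt φ' (-(q t * φ t)) t)
    {A B : ℝ} (hA : ∀ t, |φ' t| ≤ A) (hB : ∀ t, |φ t| ≤ B) {t₀ : ℝ} (h0 : φ t₀ = 0)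
    (ha : φ' t₀ ≠ 0) : False := by
  obtain ⟨C, hC⟩ := aux_Sb
  have cφ : Continuous φ := continuous_iff_continuousAt.2 fun t => (hφ t).continuousAt
  have cφ' : Continuous φ' := continuous_iff_continuousAt.2 fun t => (hφ' t).continuousAt
  have hC0 : 0 ≤ C := (abs_nonneg _).trans (hC 0)
  have hA0 : 0 ≤ A := (abs_nonneg _).trans (hA 0)
  have hB0 : 0 ≤ B := (abs_nonneg _).trans (hB 0)
  set a := φ' t₀ with hadef
  have ha2 : 0 < a ^ 2 := by positivity
  have cS := Real.smoothTransition.continuous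
  have cS' := aux_Sc
  set S := Real.smoothTransition with hS
  -- the fixed bump
  let h : ℝ → ℝ := fun t => S (t - t₀ + 2) * S (t₀ + 3 - t)
  let h' : ℝ → ℝ := fun t => deriv S (t - t₀ + 2) * S (t₀ + 3 - t)
    + S (t - t₀ + 2) * (-deriv S (t₀ + 3 - t))
  have hh : ∀ t, HasDerivAt h (h' t) t := by
    intro t
    have e1 : HasDerivAt (fun t => S (t - t₀ + 2)) (deriv S (t - t₀ + 2)) t := by
      have := (aux_Sd (t - t₀ + 2)).comp t (((hasDerivAt_id t).sub_const t₀).add_const 2)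
      simpa [Function.comp_def] using this
    have e2 : HasDerivAt (fun t => S (t₀ + 3 - t)) (-deriv S (t₀ + 3 - t)) t := by
      have := (aux_Sd (t₀ + 3 - t)).comp t ((hasDerivAt_id t).const_sub (t₀ + 3))
      simpa [Function.comp_def] using this
    exact e1.mul e2
  have ch : Continuous h' := by simp only [h']; fun_prop
  set K := ∫ t, (h' t ^ 2 - q t * h t ^ 2) with hK
  set κ : ℝ := 1 / (2 * (|K| + 1)) with hκ
  have hκ0 : 0 < κ := by positivity
  have hκK : κ * K < 1 / 2 := by
    have : κ * (|K| + 1) = 1 / 2 := by rw [hκ]; field_simp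
    nlinarith [le_abs_self K]
  -- small scale
  have hev : ∀ᶠ t in nhds t₀, a ^ 2 / 2 < a * φ' t := by
    have : ContinuousAt (fun t => a * φ' t) t₀ := by fun_prop
    refine this.eventually_const_lt ?_
    change a ^ 2 / 2 < a * a; nlinarith
  obtain ⟨d, hd, hd'⟩ := Metric.eventually_nhds_iff.1 hev
  set δ : ℝ := min 1 (min (d / 2) (κ * a ^ 2 / (4 * (A ^ 2 * C ^ 2 + 1)))) with hδ
  have hδ0 : 0 < δ := by positivity
  have hδ1 : δ ≤ 1 := min_le_left _ _
  have hδd : δ < d := lt_of_le_of_lt ((min_le_right _ _).trans (min_le_left _ _)) (by linarith)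
  have hδA : A ^ 2 * C ^ 2 * δ ≤ κ * a ^ 2 / 4 := by
    have h1 : δ ≤ κ * a ^ 2 / (4 * (A ^ 2 * C ^ 2 + 1)) :=
      (min_le_right _ _).trans (min_le_right _ _)
    rw [le_div_iff₀ (by positivity)] at h1
    nlinarith
  set L : ℝ := max 4 (12 * (B ^ 2 * C ^ 2 + 1) / (κ * a ^ 2)) with hL
  have hL4 : 4 ≤ L := le_max_left _ _
  have hL0 : 0 < L := by linarith
  have hLB : B ^ 2 * C ^ 2 / L ^ 2 * (3 * L) ≤ κ * a ^ 2 / 4 := by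
    have h1 : 12 * (B ^ 2 * C ^ 2 + 1) / (κ * a ^ 2) ≤ L := le_max_right _ _
    rw [div_le_iff₀ (by positivity)] at h1
    have : B ^ 2 * C ^ 2 / L ^ 2 * (3 * L) = 3 * (B ^ 2 * C ^ 2) / L := by field_simp
    rw [this, div_le_iff₀ hL0]
    nlinarith
  let e : ℝ → ℝ := fun t => deriv S ((t - t₀) / δ) / δ
  let η : ℝ → ℝ := fun t => S ((t - t₀) / δ) * S (2 - (t - t₀) / L)
  let η' : ℝ → ℝ := fun t => e t * S (2 - (t - t₀) / L)
    + S ((t - t₀) / δ) * (-(deriv S (2 - (t - t₀) / L) / L))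
  have he : ∀ t, HasDerivAt (fun t => S ((t - t₀) / δ)) (e t) t := by
    intro t
    have := (aux_Sd ((t - t₀) / δ)).comp t (((hasDerivAt_id t).sub_const t₀).div_const δ)
    simpa [Function.comp_def, e, div_eq_mul_inv] using this
  have hη : ∀ t, HasDerivAt η (η' t) t := by
    intro t
    have e2 : HasDerivAt (fun t => S (2 - (t - t₀) / L)) (-(deriv S (2 - (t - t₀) / L) / L)) t := by
      have := (aux_Sd (2 - (t - t₀) / L)).comp t
        ((((hasDerivAt_id t).sub_const t₀).div_const L).const_sub 2)
      simpa [Function.comp_def, div_eq_mul_inv] using this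
    exact (he t).mul e2
  have ce : Continuous e := by simp only [e]; fun_prop
  have cη : Continuous η' := by simp only [η']; fun_prop
  have zη : ∀ t, t ∉ Set.Icc (t₀ - 2) (t₀ + 2 * L) → η t = 0 := by
    intro t ht
    simp only [Set.mem_Icc, not_and_or, not_le] at ht
    rcases ht with ht | ht
    · have : S ((t - t₀) / δ) = 0 := Real.smoothTransition.zero_of_nonpos
        (div_nonpos_of_nonpos_of_nonneg (by linarith) hδ0.le)
      simp [η, this]
    · have : S (2 - (t - t₀) / L) = 0 := Real.smoothTransition.zero_of_nonpos (by
        rw [sub_nonpos, le_div_iff₀ hL0]; linarith)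
      simp [η, this]
  have zh : ∀ t, t ∉ Set.Icc (t₀ - 2) (t₀ + 2 * L) → h t = 0 := by
    intro t ht
    simp only [Set.mem_Icc, not_and_or, not_le] at ht
    rcases ht with ht | ht
    · have : S (t - t₀ + 2) = 0 := Real.smoothTransition.zero_of_nonpos (by linarith)
      simp [h, this]
    · have : S (t₀ + 3 - t) = 0 := Real.smoothTransition.zero_of_nonpos (by linarith)
      simp [h, this]
  have main := aux_identity hq hstable hφ hφ' hη hh cη ch (by linarith) zη zh (κ * a)
  rw [← hK] at main
  set E : ℝ → ℝ := fun t => φ t ^ 2 * η' t ^ 2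
    + 2 * (κ * a) * η' t * (φ t * h' t - φ' t * h t) with hE
  have ch0 : Continuous h := by simp only [h]; fun_prop
  have cE : Continuous E := by simp only [hE]; fun_prop
  have I : ∀ x y, IntervalIntegrable E volume x y := fun x y => cE.intervalIntegrable x y
  change 0 ≤ (∫ t in (t₀ - 2 - 1)..(t₀ + 2 * L + 1), E t) + _ at main
  rw [← intervalIntegral.integral_add_adjacent_intervals (I _ t₀) (I t₀ _),
    ← intervalIntegral.integral_add_adjacent_intervals (I t₀ (t₀ + δ)) (I (t₀ + δ) _)] at main
  have p1 : ∫ t in (t₀ - 2 - 1)..t₀, E t = 0 := by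
    rw [intervalIntegral.integral_congr (g := fun _ => (0:ℝ))]
    · simp
    intro t ht
    rw [Set.uIcc_of_le (by linarith)] at ht
    have hn : (t - t₀) / δ ≤ 0 := div_nonpos_of_nonpos_of_nonneg (by linarith [ht.2]) hδ0.le
    have : η' t = 0 := by
      simp only [η', e]
      rw [aux_S0 hn, hS, Real.smoothTransition.zero_of_nonpos hn]; simp
    simp [hE, this]
  have Ie : ∫ t in t₀..(t₀ + δ), e t = 1 := by
    rw [intervalIntegral.integral_eq_sub_of_hasDerivAt (fun t _ => he t)
      (ce.intervalIntegrable _ _)]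
    simp [hS, hδ0.ne']
  have p2 : ∫ t in t₀..(t₀ + δ), E t ≤ A ^ 2 * C ^ 2 * δ - κ * a ^ 2 := by
    have : ∫ t in t₀..(t₀ + δ), (A ^ 2 * C ^ 2 - κ * a ^ 2 * e t)
        = A ^ 2 * C ^ 2 * δ - κ * a ^ 2 := by
      rw [intervalIntegral.integral_sub (by simp)
        ((ce.intervalIntegrable _ _).const_mul _), intervalIntegral.integral_const_mul (κ * a ^ 2), Ie]
      simp; ring
    rw [← this]
    refine intervalIntegral.integral_mono_on (by linarith) (I _ _)
      (Continuous.intervalIntegrable (by fun_prop) _ _) ?_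
    intro t ht
    have ht1 := ht.1
    have ht2 := ht.2
    have h2 : 1 ≤ 2 - (t - t₀) / L := by
      have : (t - t₀) / L ≤ 1 := by rw [div_le_one hL0]; linarith
      linarith
    have hη'e : η' t = e t := by
      simp only [η']
      rw [aux_S1 h2, hS, Real.smoothTransition.one_of_one_le h2]; simp
    have hh1 : h t = 1 := by
      simp only [h]
      rw [hS, Real.smoothTransition.one_of_one_le (by linarith),
        Real.smoothTransition.one_of_one_le (by linarith)]; simp
    have hh2 : h' t = 0 := by
      simp only [h']
      rw [aux_S1 (by linarith), aux_S1 (by linarith)]; simp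
    have he0 : 0 ≤ e t := div_nonneg Real.smoothTransition.monotone.deriv_nonneg hδ0.le
    have heC : e t ≤ C / δ := by
      simp only [e]; gcongr; exact (le_abs_self _).trans (hC _)
    have hφA : |φ t| ≤ A * δ := by
      have := Convex.norm_image_sub_le_of_norm_hasDerivWithin_le (f := φ) (f' := φ') (C := A)
        (s := Set.univ) (x := t₀) (y := t) (fun x _ => (hφ x).hasDerivWithinAt)
        (fun x _ => hA x) convex_univ trivial trivial
      rw [h0, sub_zero, Real.norm_eq_abs, Real.norm_eq_abs, abs_of_nonneg (sub_nonneg.2 ht1)] at this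
      refine this.trans ?_
      gcongr; linarith
    have hsq : φ t ^ 2 * e t ^ 2 ≤ A ^ 2 * C ^ 2 := by
      calc φ t ^ 2 * e t ^ 2 = |φ t| ^ 2 * e t ^ 2 := by rw [sq_abs]
        _ ≤ (A * δ) ^ 2 * (C / δ) ^ 2 := by gcongr
        _ = A ^ 2 * C ^ 2 := by field_simp
    have had : a ^ 2 / 2 < a * φ' t := hd' (by
      rw [Real.dist_eq, abs_of_nonneg (sub_nonneg.2 ht1)]; linarith)
    simp only [hE, hη'e, hh1, hh2]
    have hfin := mul_nonneg (mul_nonneg hκ0.le he0) (sub_nonneg.2 had.le)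
    linarith
  have p3 : ∫ t in (t₀ + δ)..(t₀ + 2 * L + 1), E t ≤ κ * a ^ 2 / 4 := by
    have hc : ∫ t in (t₀ + δ)..(t₀ + 2 * L + 1), (B ^ 2 * C ^ 2 / L ^ 2) ≤ κ * a ^ 2 / 4 := by
      rw [intervalIntegral.integral_const, smul_eq_mul, mul_comm]
      refine le_trans ?_ hLB
      gcongr; linarith
    refine le_trans ?_ hc
    refine intervalIntegral.integral_mono_on (by linarith) (I _ _)
      (Continuous.intervalIntegrable (by fun_prop) _ _) ?_
    intro t ht
    have ht1 := ht.1
    have hge : 1 ≤ (t - t₀) / δ := by rw [le_div_iff₀ hδ0]; linarith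
    have hη'e : η' t = -(deriv S (2 - (t - t₀) / L) / L) := by
      simp only [η', e]
      rw [aux_S1 hge, hS, Real.smoothTransition.one_of_one_le hge]; simp
    have hx : η' t * (φ t * h' t - φ' t * h t) = 0 := by
      rcases le_or_gt (t - t₀) L with hl | hl
      · have : (t - t₀) / L ≤ 1 := by rw [div_le_one hL0]; linarith
        rw [hη'e, aux_S1 (by linarith)]; simp
      · have n : t₀ + 3 - t ≤ 0 := by linarith
        have hh1 : h t = 0 := by
          simp only [h]; rw [hS, Real.smoothTransition.zero_of_nonpos n]; simp
        have hh2 : h' t = 0 := by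
          simp only [h']; rw [aux_S0 n, hS, Real.smoothTransition.zero_of_nonpos n]; simp
        rw [hh1, hh2]; simp
    have hsq : φ t ^ 2 * η' t ^ 2 ≤ B ^ 2 * C ^ 2 / L ^ 2 := by
      calc φ t ^ 2 * η' t ^ 2 = |φ t| ^ 2 * (|deriv S (2 - (t - t₀) / L)| / L) ^ 2 := by
            rw [sq_abs, hη'e, neg_sq, div_pow, div_pow, sq_abs]
        _ ≤ B ^ 2 * (C / L) ^ 2 := by
            gcongr
            · exact hB t
            · exact hC _
        _ = B ^ 2 * C ^ 2 / L ^ 2 := by ring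
    simp only [hE]
    rw [mul_assoc, hx]; linarith
  have : (κ * a) ^ 2 * K = (κ * a ^ 2) * (κ * K) := by ring
  have hpos : 0 < κ * a ^ 2 := by positivity
  rw [p1, this] at main
  have hlast := mul_lt_mul_of_pos_left hκK hpos
  linarith

theorem stable_1d_solution_strictly_monotone
    (f g : ℝ → ℝ) (hf : ContDiff ℝ 1 f) (hg : ContDiff ℝ 2 g)
    (hode : ∀ t, deriv (deriv g) t + f (g t) = 0)
    (hbdd : ∃ M : ℝ, ∀ t, |g t| ≤ M)
    (hstable : ∀ ψ : ℝ → ℝ, ContDiff ℝ (⊤ : ℕ∞) ψ → HasCompactSupport ψ →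
      0 ≤ ∫ t, ((deriv ψ t) ^ 2 - deriv f (g t) * ψ t ^ 2))
    (hnonconst : ∃ s t, g s ≠ g t) :
    (StrictMono g ∨ StrictAnti g) ∧ ∀ t, deriv g t ≠ 0 := by
  obtain ⟨M, hM⟩ := hbdd
  have hg1 : ∀ t, HasDerivAt g (deriv g t) t := fun t =>
    (hg.differentiable (by simp) t).hasDerivAt
  have hdg : ContDiff ℝ 1 (deriv g) := by
    have : ContDiff ℝ (1 + 1) g := by simpa [one_add_one_eq_two] using hg
    exact (contDiff_succ_iff_deriv.1 this).2.2
  have hφ : ∀ t, HasDerivAt (deriv g) (-f (g t)) t := fun t => by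
    have := (hdg.differentiable (by simp) t).hasDerivAt
    rwa [eq_neg_of_add_eq_zero_left (hode t)] at this
  have cdf : Continuous (deriv f) := hf.continuous_deriv le_rfl
  have hq : Continuous fun t => deriv f (g t) := cdf.comp hg.continuous
  have hφ' : ∀ t, HasDerivAt (fun t => -f (g t)) (-(deriv f (g t) * deriv g t)) t := fun t =>
    (((hf.differentiable (by simp) (g t)).hasDerivAt).comp t (hg1 t)).neg
  have hmem : ∀ t, g t ∈ Set.Icc (-M) M := fun t => abs_le.1 (hM t)
  obtain ⟨A, hA⟩ := (isCompact_Icc (a := -M) (b := M)).exists_bound_of_continuousOn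
    hf.continuous.continuousOn
  obtain ⟨Q, hQ⟩ := (isCompact_Icc (a := -M) (b := M)).exists_bound_of_continuousOn
    cdf.continuousOn
  have hA' : ∀ t, |-f (g t)| ≤ A := fun t => by rw [abs_neg]; exact hA _ (hmem t)
  have hB : ∀ t, |deriv g t| ≤ 2 * M + A := by
    intro t
    obtain ⟨x, hx, hx'⟩ := exists_hasDerivAt_eq_slope g (deriv g) (by linarith : t < t + 1)
      hg.continuous.continuousOn (fun x _ => hg1 x)
    rw [add_sub_cancel_left, div_one] at hx'
    have h1 := Convex.norm_image_sub_le_of_norm_hasDerivWithin_le (f := deriv g) 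
      (f' := fun t => -f (g t)) (C := A)
      (s := Set.univ) (x := t) (y := x) (fun x _ => (hφ x).hasDerivWithinAt)
      (fun x _ => hA' x) convex_univ trivial trivial
    rw [Real.norm_eq_abs, Real.norm_eq_abs, abs_of_nonneg (by linarith [hx.1] : 0 ≤ x - t)] at h1
    have hA0 : 0 ≤ A := (abs_nonneg _).trans (hA' 0)
    have h2 : A * (x - t) ≤ A := by nlinarith [hx.2]
    have h3 := abs_le.1 (h1.trans h2)
    have h4 := abs_le.1 (hM t)
    have h5 := abs_le.1 (hM (t+1))
    rw [abs_le]
    constructor <;> linarith [h3.1, h3.2, h4.1, h4.2, h5.1, h5.2]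
  have hne : ∀ t, deriv g t ≠ 0 := by
    intro t₀ h0
    by_cases ha : -f (g t₀) = 0
    · -- uniqueness for the linearized equation
      have hlip : ∀ t : ℝ, LipschitzOnWith (max 1 Q.toNNReal)
          (fun z : ℝ × ℝ => ((z.2, -(deriv f (g t) * z.1)) : ℝ × ℝ)) Set.univ := by
        intro t
        rw [lipschitzOnWith_univ]
        refine LipschitzWith.prodMk LipschitzWith.prod_snd ?_
        refine LipschitzWith.of_dist_le_mul fun x y => ?_
        rw [Real.dist_eq]
        have e1 : -(deriv f (g t) * x.1) - -(deriv f (g t) * y.1)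
          = -(deriv f (g t) * (x.1 - y.1)) := by ring
        rw [e1, abs_neg, abs_mul, ← Real.dist_eq]
        gcongr
        · exact (hQ _ (hmem t)).trans (Real.le_coe_toNNReal Q)
        · exact le_max_left _ _
      have hu := ODE_solution_unique_univ (t₀ := t₀) hlip
        (f := fun t => (deriv g t, -f (g t))) (g := fun _ => (0, 0))
        (fun t => ⟨(hφ t).prodMk (hφ' t), trivial⟩)
        (fun t => ⟨(hasDerivAt_const t ((0:ℝ),(0:ℝ))).congr_deriv (by ext <;> simp), trivial⟩)
        (by simp only [h0, ha])
      obtain ⟨s, t, hst⟩ := hnonconst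
      refine hst (is_const_of_deriv_eq_zero (hg.differentiable (by simp)) (fun x => ?_) s t)
      exact congrArg Prod.fst (congrFun hu x)
    · exact aux_core hq hstable hφ hφ' hA' hB h0 ha
  refine ⟨?_, hne⟩
  rcases hasDerivWithinAt_forall_lt_or_forall_gt_of_forall_ne (f := g) (f' := deriv g)
    convex_univ (fun x _ => (hg1 x).hasDerivWithinAt) (fun x _ => hne x) with h | h
  · exact Or.inr (strictAnti_of_deriv_neg fun x => h x trivial)
  · exact Or.inl (strictMono_of_deriv_pos fun x => h x trivial)
end
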